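/- Let A ∈ ℂ^{n₁×n₁×n₃} with ind(A) = k ≥ 1, let A^{GD} be a GD inverse of A, let A† be the Moore–Penrose inverse of A, and set A^{GD,†} = A^{GD} ⋆ A ⋆ A†. Then: (a) A^{GD,†} = A^{GD} ⋆ A ⋆ A^{GD,†}; (b) A ⋆ A^{GD,†} ⋆ A = A and A^{GD,†} ⋆ A ⋆ A^{GD,†} = A^{GD,†}; (c) for every positive integer c, A^c ⋆ A^{GD,†} = A^c ⋆ A† and A^{GD,†} ⋆ A^c = A^{GD} ⋆ A^c; (d) A^{GD,†} ⋆ A^{k+1} = A^k; (e) A ⋆ A^{GD,†} ⋆ A^{k+1} = A^{k+1}; (f) A^{k+1} ⋆ A^{GD,†} = A^k ⋆ A ⋆ A†; (g) A^{GD,†} ⋆ A^{k+2} ⋆ A^{GD,†} = A^{k+1} ⋆ A†. -/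

import Mathlib

open Matrix BigOperators

/-- A third-order complex tensor in `ℂ^{n₁ × n₂ × n₃}`, given by its frontal slices. -/
abbrev Tensor3 (n₁ n₂ n₃ : ℕ) := Fin n₃ → Matrix (Fin n₁) (Fin n₂) ℂ

/-- Mode-3 product of a tensor with an `n₃ × n₃` matrix: the slices of the result are the
indicated linear combinations of the slices of `A`. -/
noncomputable def mode3 {n₁ n₂ n₃ : ℕ} (M : Matrix (Fin n₃) (Fin n₃) ℂ) (A : Tensor3 n₁ n₂ n₃) :
    Tensor3 n₁ n₂ n₃ :=
  fun i => ∑ j, M i j • A j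

/-- The M-product `A ⋆_M B`: slice-wise matrix product in the transformed (hat) domain,
transformed back by `M⁻¹`. -/
noncomputable def mprod {n₁ n₂ l n₃ : ℕ} (M : Matrix (Fin n₃) (Fin n₃) ℂ)
    (A : Tensor3 n₁ n₂ n₃) (B : Tensor3 n₂ l n₃) : Tensor3 n₁ l n₃ :=
  mode3 M⁻¹ (fun i => mode3 M A i * mode3 M B i)

/-- The identity tensor: every slice of its mode-3 transform is the identity matrix. -/
noncomputable def idT (n₁ : ℕ) {n₃ : ℕ} (M : Matrix (Fin n₃) (Fin n₃) ℂ) : Tensor3 n₁ n₁ n₃ :=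
  mode3 M⁻¹ (fun _ => (1 : Matrix (Fin n₁) (Fin n₁) ℂ))

/-- Powers of a square tensor with respect to the M-product. -/
noncomputable def mpow {n₁ n₃ : ℕ} (M : Matrix (Fin n₃) (Fin n₃) ℂ) (A : Tensor3 n₁ n₁ n₃) :
    ℕ → Tensor3 n₁ n₁ n₃
  | 0 => idT n₁ M
  | k + 1 => mprod M (mpow M A k) A

/-- Conjugate transpose with respect to the M-product: slice-wise conjugate transpose in the
transformed domain. -/
noncomputable def ctrans {n₁ n₂ n₃ : ℕ} (M : Matrix (Fin n₃) (Fin n₃) ℂ) (A : Tensor3 n₁ n₂ n₃) :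
    Tensor3 n₂ n₁ n₃ :=
  mode3 M⁻¹ (fun i => (mode3 M A i)ᴴ)

/-- Index of a square complex matrix: the least `k ≥ 0` with `rank(B^k) = rank(B^{k+1})`. -/
noncomputable def matIndex {n : ℕ} (B : Matrix (Fin n) (Fin n) ℂ) : ℕ :=
  sInf {k : ℕ | (B ^ k).rank = (B ^ (k + 1)).rank}

/-- Index of a tensor: the maximum of the indices of the slices of its mode-3 transform. -/
noncomputable def tIndex {n₁ n₃ : ℕ} (M : Matrix (Fin n₃) (Fin n₃) ℂ)
    (A : Tensor3 n₁ n₁ n₃) : ℕ :=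
  Finset.univ.sup fun i => matIndex (mode3 M A i)

/-- `X` is a GD inverse of `A` with exponent `k`:
`A ⋆ X ⋆ A = A`, `X ⋆ A^{k+1} = A^k`, `A^{k+1} ⋆ X = A^k`. -/
def IsGD {n₁ n₃ : ℕ} (M : Matrix (Fin n₃) (Fin n₃) ℂ) (A X : Tensor3 n₁ n₁ n₃)
    (k : ℕ) : Prop :=
  mprod M (mprod M A X) A = A ∧
  mprod M X (mpow M A (k + 1)) = mpow M A k ∧
  mprod M (mpow M A (k + 1)) X = mpow M A k

/-- `X` is the Drazin inverse of `A` with exponent `k`. -/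
def IsDrazin {n₁ n₃ : ℕ} (M : Matrix (Fin n₃) (Fin n₃) ℂ) (A X : Tensor3 n₁ n₁ n₃)
    (k : ℕ) : Prop :=
  mprod M X (mpow M A (k + 1)) = mpow M A k ∧
  mprod M (mprod M X A) X = X ∧
  mprod M X A = mprod M A X

/-- `X` is the Moore–Penrose inverse of `A`. -/
def IsMP {n₁ n₃ : ℕ} (M : Matrix (Fin n₃) (Fin n₃) ℂ) (A X : Tensor3 n₁ n₁ n₃) : Prop :=
  mprod M (mprod M A X) A = A ∧
  mprod M (mprod M X A) X = X ∧
  ctrans M (mprod M A X) = mprod M A X ∧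
  ctrans M (mprod M X A) = mprod M X A

theorem mode3_mode3 {n₁ n₂ n₃ : ℕ} (M N : Matrix (Fin n₃) (Fin n₃) ℂ) (A : Tensor3 n₁ n₂ n₃) :
    mode3 M (mode3 N A) = mode3 (M * N) A := by
  funext i
  simp only [mode3, Matrix.mul_apply, Finset.smul_sum, Finset.sum_smul, smul_smul]
  exact Finset.sum_comm

theorem mode3_one {n₁ n₂ n₃ : ℕ} (A : Tensor3 n₁ n₂ n₃) :
    mode3 (1 : Matrix (Fin n₃) (Fin n₃) ℂ) A = A := by
  funext i
  simp [mode3, Matrix.one_apply, ite_smul]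

theorem mode3_mode3_inv {n₁ n₂ n₃ : ℕ} {M : Matrix (Fin n₃) (Fin n₃) ℂ} (hM : IsUnit M)
    (A : Tensor3 n₁ n₂ n₃) : mode3 M (mode3 M⁻¹ A) = A := by
  rw [mode3_mode3, Matrix.mul_nonsing_inv _ ((Matrix.isUnit_iff_isUnit_det _).mp hM), mode3_one]

theorem mode3_injective {n₁ n₂ n₃ : ℕ} {M : Matrix (Fin n₃) (Fin n₃) ℂ} (hM : IsUnit M) :
    Function.Injective (mode3 M : Tensor3 n₁ n₂ n₃ → Tensor3 n₁ n₂ n₃) := by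
  refine Function.LeftInverse.injective (g := mode3 M⁻¹) fun A => ?_
  rw [mode3_mode3, Matrix.nonsing_inv_mul _ ((Matrix.isUnit_iff_isUnit_det _).mp hM), mode3_one]

theorem mode3_mprod {n₁ n₃ : ℕ} {M : Matrix (Fin n₃) (Fin n₃) ℂ} (hM : IsUnit M)
    (A B : Tensor3 n₁ n₁ n₃) : mode3 M (mprod M A B) = mode3 M A * mode3 M B :=
  mode3_mode3_inv hM _

theorem mode3_mpow {n₁ n₃ : ℕ} {M : Matrix (Fin n₃) (Fin n₃) ℂ} (hM : IsUnit M)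
    (A : Tensor3 n₁ n₁ n₃) (k : ℕ) : mode3 M (mpow M A k) = mode3 M A ^ k := by
  induction k with
  | zero => exact mode3_mode3_inv hM _
  | succ k ih => rw [mpow, mode3_mprod hM, ih, pow_succ]

/-- The algebraic properties of `g * a * d` in a monoid, for inner inverses `g` and `d` of `a`
such that `g * a ^ (k + 1) = a ^ k`. -/
theorem gdmp_properties_monoid {R : Type*} [Monoid R] {a g d : R} {k : ℕ}
    (hg : a * g * a = a) (hgk : g * a ^ (k + 1) = a ^ k) (hd : a * d * a = a) :
    g * a * d = g * a * (g * a * d) ∧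
    (a * (g * a * d) * a = a ∧ g * a * d * a * (g * a * d) = g * a * d) ∧
    (∀ c : ℕ, 1 ≤ c → a ^ c * (g * a * d) = a ^ c * d ∧ g * a * d * a ^ c = g * a ^ c) ∧
    g * a * d * a ^ (k + 1) = a ^ k ∧
    a * (g * a * d) * a ^ (k + 1) = a ^ (k + 1) ∧
    a ^ (k + 1) * (g * a * d) = a ^ k * a * d ∧
    g * a * d * a ^ (k + 2) * (g * a * d) = a ^ (k + 1) * d := by
  have hag : ∀ z, a * (g * (a * z)) = a * z := fun z => by
    rw [← mul_assoc, ← mul_assoc, hg]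
  have had : ∀ z, a * (d * (a * z)) = a * z := fun z => by
    rw [← mul_assoc, ← mul_assoc, hd]
  have hd' : a * (d * a) = a := by rw [← mul_assoc, hd]
  have hl : ∀ c : ℕ, a ^ (c + 1) * (g * a * d) = a ^ (c + 1) * d := fun c => by
    simp only [pow_succ, mul_assoc, hag]
  have hr : ∀ c : ℕ, g * a * d * a ^ (c + 1) = g * a ^ (c + 1) := fun c => by
    simp only [pow_succ', mul_assoc, had]
  refine ⟨by simp only [mul_assoc, hag], ⟨by simp only [mul_assoc, hag, hd'],
    by simp only [mul_assoc, hag, had]⟩, ?_, by rw [hr, hgk], ?_, by rw [hl, pow_succ], ?_⟩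
  · rintro (_ | c) hc
    · omega
    · exact ⟨hl c, hr c⟩
  · rw [mul_assoc, hr, pow_succ', hag]
  · rw [hr, pow_succ a (k + 1), ← mul_assoc g (a ^ (k + 1)) a, hgk, ← pow_succ, hl]

/-- properties (a)–(g) of the GDMP inverse `A^{GD,†} = A^{GD} ⋆ A ⋆ A†`. -/
theorem gdmp_properties {n₁ n₃ : ℕ} (hn₁ : 0 < n₁) (hn₃ : 0 < n₃)
    (M : Matrix (Fin n₃) (Fin n₃) ℂ) (hM : IsUnit M)
    (A AGD Adag X : Tensor3 n₁ n₁ n₃) (k : ℕ) (hk : tIndex M A = k) (hk1 : 1 ≤ k)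
    (hAGD : IsGD M A AGD k) (hAdag : IsMP M A Adag)
    (hX : X = mprod M (mprod M AGD A) Adag) :
    -- (a)
    (X = mprod M (mprod M AGD A) X) ∧
    -- (b) A^{GD,†} ∈ A{1,2}
    (mprod M (mprod M A X) A = A ∧ mprod M (mprod M X A) X = X) ∧
    -- (c)
    (∀ c : ℕ, 1 ≤ c →
      mprod M (mpow M A c) X = mprod M (mpow M A c) Adag ∧
      mprod M X (mpow M A c) = mprod M AGD (mpow M A c)) ∧
    -- (d)
    (mprod M X (mpow M A (k + 1)) = mpow M A k) ∧
    -- (e)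
    (mprod M (mprod M A X) (mpow M A (k + 1)) = mpow M A (k + 1)) ∧
    -- (f)
    (mprod M (mpow M A (k + 1)) X = mprod M (mprod M (mpow M A k) A) Adag) ∧
    -- (g)
    (mprod M (mprod M X (mpow M A (k + 2))) X = mprod M (mpow M A (k + 1)) Adag) := by
  obtain ⟨hg, hgk, -⟩ := hAGD
  obtain ⟨hd, -, -, -⟩ := hAdag
  subst hX
  have h := gdmp_properties_monoid (a := mode3 M A) (g := mode3 M AGD) (d := mode3 M Adag) (k := k)
  simp only [← mode3_mprod hM, ← mode3_mpow hM, (mode3_injective hM).eq_iff] at h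
  exact h hg hgk hd
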